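/- Let H̃ ∈ C²(ℝ^m), H_i = ∂_iH̃, and let u = (u_1,…,u_m), u_i ∈ C²(ℝ²) bounded, solve Δ_G u_i = H_i(u) on ℝ². Assume |∇_G u_i| ∈ L^∞(ℝ²) for every i; for each i the function Zu_i = ∂_y u_i has a fixed sign on ℝ² (either ∂_y u_i ≥ 0 everywhere or ∂_y u_i ≤ 0 everywhere); and there exist constants a_i with lim_{y→∞} u_i(x,y) = a_i for every x ∈ ℝ. Then there is a constant C, independent of R, such that for all R > 1, I_R(u) := ∫_{B_R} [ Σ_{i=1}^m ½·|∇_G u_i|² + H̃(u) − H̃(a) ] dxdy ≤ C·R², where a = (a_1,…,a_m) and B_R = {(x,y) ∈ ℝ² : x⁴ + y² < R⁴}. -/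

import Mathlib

open MeasureTheory Real Filter

/-- Partial derivative in the `x`-variable. -/
noncomputable def pdx (u : ℝ × ℝ → ℝ) (p : ℝ × ℝ) : ℝ :=
  deriv (fun t => u (t, p.2)) p.1

/-- Partial derivative in the `y`-variable. -/
noncomputable def pdy (u : ℝ × ℝ → ℝ) (p : ℝ × ℝ) : ℝ :=
  deriv (fun t => u (p.1, t)) p.2

/-- The Grushin vector field `X u = ∂ₓ u`. -/
noncomputable def Xg (u : ℝ × ℝ → ℝ) (p : ℝ × ℝ) : ℝ := pdx u p

/-- The Grushin vector field `Y u = x·∂_y u`. -/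
noncomputable def Yg (u : ℝ × ℝ → ℝ) (p : ℝ × ℝ) : ℝ := p.1 * pdy u p

/-- The commutator field `Z u = ∂_y u`. -/
noncomputable def Zg (u : ℝ × ℝ → ℝ) (p : ℝ × ℝ) : ℝ := pdy u p

/-- The Grushin Laplacian `Δ_G u = X(Xu) + Y(Yu)`. -/
noncomputable def deltaG (u : ℝ × ℝ → ℝ) (p : ℝ × ℝ) : ℝ := Xg (Xg u) p + Yg (Yg u) p

/-- The norm of the Grushin gradient, `|∇_G u| = √((Xu)² + (Yu)²)`. -/
noncomputable def normG (u : ℝ × ℝ → ℝ) (p : ℝ × ℝ) : ℝ :=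
  Real.sqrt ((Xg u p) ^ 2 + (Yg u p) ^ 2)

/-- The `j`-th partial derivative of a function `H : ℝ^m → ℝ`. -/
noncomputable def pdH {m : ℕ} (H : (Fin m → ℝ) → ℝ) (j : Fin m) (v : Fin m → ℝ) : ℝ :=
  fderiv ℝ H v (Pi.single j 1)

/-- Intrinsic curvature `𝒜` of the level sets. -/
noncomputable def curvA (u : ℝ × ℝ → ℝ) (p : ℝ × ℝ) : ℝ :=
  ((normG u p) ^ 3)⁻¹ *
    (Xg (Xg u) p * (Yg u p) ^ 2 - Xg (Yg u) p * Xg u p * Yg u p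
      - Yg (Xg u) p * Xg u p * Yg u p + Yg (Yg u) p * (Xg u p) ^ 2)

/-- Intrinsic tangential quantity `ℬ` of the level sets. -/
noncomputable def curvB (u : ℝ × ℝ → ℝ) (p : ℝ × ℝ) : ℝ :=
  ((normG u p) ^ 3)⁻¹ *
    (Xg (Xg u) p * Xg u p * Yg u p - Xg (Yg u) p * (Xg u p) ^ 2
      + Yg (Xg u) p * (Yg u p) ^ 2 - Yg (Yg u) p * Xg u p * Yg u p)

/-- The Grushin ball `B_R = {(x,y) : x⁴ + y² < R⁴}`. -/
def ballG (R : ℝ) : Set (ℝ × ℝ) := {p : ℝ × ℝ | p.1 ^ 4 + p.2 ^ 2 < R ^ 4}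

/-- The Grushin norm `‖(x,y)‖_G = (x⁴+y²)^(1/4)`. -/
noncomputable def grushinNorm (p : ℝ × ℝ) : ℝ := (p.1 ^ 4 + p.2 ^ 2) ^ ((1 : ℝ) / 4)

theorem setIntegral_le_of_slices {S : Set (ℝ × ℝ)} (hS : MeasurableSet S) {f : ℝ × ℝ → ℝ}
    (hf : IntegrableOn f S) {b K : ℝ} (hb : 0 ≤ b)
    (hin : ∀ x ∈ Set.Icc (-b) b, ∃ r, 0 ≤ r ∧ Prod.mk x ⁻¹' S = Set.Ioo (-r) r ∧
      ∫ y in (-r)..r, f (x, y) ≤ K)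
    (hout : ∀ x ∉ Set.Icc (-b) b, Prod.mk x ⁻¹' S = ∅) :
    ∫ p in S, f p ≤ 2 * b * K := by
  have hint : Integrable (S.indicator f) ((volume : Measure ℝ).prod volume) :=
    (integrable_indicator_iff hS).2 hf
  have hslice (x : ℝ) : (fun y => S.indicator f (x, y))
      = (Prod.mk x ⁻¹' S).indicator (fun y => f (x, y)) := rfl
  have hle (x : ℝ) : ∫ y, S.indicator f (x, y)
      ≤ (Set.Icc (-b) b).indicator (fun _ => K) x := by
    rw [hslice]
    by_cases hx : x ∈ Set.Icc (-b) b
    · obtain ⟨r, hr, hs, hK⟩ := hin x hx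
      rw [hs, integral_indicator measurableSet_Ioo, Set.indicator_of_mem hx,
        ← integral_Ioc_eq_integral_Ioo, ← intervalIntegral.integral_of_le (by linarith)]
      exact hK
    · simp [hout x hx, Set.indicator_of_notMem hx]
  calc ∫ p in S, f p = ∫ x, ∫ y, S.indicator f (x, y) := by
        rw [← integral_indicator hS, Measure.volume_eq_prod, integral_prod _ hint]
    _ ≤ ∫ x, (Set.Icc (-b) b).indicator (fun _ => K) x :=
        integral_mono hint.integral_prod_left
          ((integrable_indicator_iff measurableSet_Icc).2 (by simp)) hle
    _ = 2 * b * K := by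
        rw [integral_indicator measurableSet_Icc]
        rw [setIntegral_const, Real.volume_real_Icc_of_le (by linarith), smul_eq_mul]
        ring

theorem measurableSet_ballG (R : ℝ) : MeasurableSet (ballG R) :=
  (isOpen_lt (by fun_prop) (by fun_prop)).measurableSet

theorem abs_lt_of_mem_ballG {R : ℝ} (hR : 0 ≤ R) {p : ℝ × ℝ} (hp : p ∈ ballG R) :
    |p.1| < R ∧ |p.2| < R ^ 2 := by
  have hp : p.1 ^ 4 + p.2 ^ 2 < R ^ 4 := hp
  constructor
  · refine lt_of_pow_lt_pow_left₀ 4 hR ?_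
    rw [Even.pow_abs (by decide)]
    nlinarith [sq_nonneg p.2]
  · refine lt_of_pow_lt_pow_left₀ 2 (by positivity) ?_
    rw [sq_abs]
    nlinarith [sq_nonneg (p.1 ^ 2)]

theorem ballG_subset_Icc {R : ℝ} (hR : 0 ≤ R) :
    ballG R ⊆ Set.Icc (-R) R ×ˢ Set.Icc (-R ^ 2) (R ^ 2) := by
  intro p hp
  obtain ⟨h1, h2⟩ := abs_lt_of_mem_ballG hR hp
  exact ⟨abs_le.1 h1.le, abs_le.1 h2.le⟩

theorem Continuous.integrableOn_ballG {f : ℝ × ℝ → ℝ} (hf : Continuous f) {R : ℝ}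
    (hR : 0 ≤ R) : IntegrableOn f (ballG R) :=
  (hf.continuousOn.integrableOn_compact (isCompact_Icc.prod isCompact_Icc)).mono_set
    (ballG_subset_Icc hR)

theorem setIntegral_ballG_le_of_vertical {f : ℝ × ℝ → ℝ} (hf : Continuous f) {R K : ℝ}
    (hR : 0 ≤ R)
    (h : ∀ x, |x| ≤ R → ∀ r, 0 ≤ r → ∫ y in (-r)..r, f (x, y) ≤ K) :
    ∫ p in ballG R, f p ≤ 2 * R * K := by
  refine setIntegral_le_of_slices (measurableSet_ballG R) (hf.integrableOn_ballG hR) hR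
    (fun x hx => ⟨√(R ^ 4 - x ^ 4), Real.sqrt_nonneg _, ?_, h x (abs_le.2 hx) _
      (Real.sqrt_nonneg _)⟩) (fun x hx => ?_)
  · ext y
    rw [Set.mem_Ioo, ← abs_lt, Real.lt_sqrt (abs_nonneg y), sq_abs, Set.mem_preimage]
    change x ^ 4 + y ^ 2 < R ^ 4 ↔ _
    exact lt_sub_iff_add_lt'.symm
  · exact Set.eq_empty_of_forall_notMem fun y hy => hx (ballG_subset_Icc hR hy).1

theorem setIntegral_ballG_le_of_horizontal {f : ℝ × ℝ → ℝ} (hf : Continuous f) {R K : ℝ}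
    (hR : 0 ≤ R) (h : ∀ y r, 0 ≤ r → ∫ x in (-r)..r, f (x, y) ≤ K) :
    ∫ p in ballG R, f p ≤ 2 * R ^ 2 * K := by
  have hswap : ∫ p in ballG R, f p = ∫ p in Prod.swap ⁻¹' ballG R, f p.swap := by
    rw [← integral_indicator (measurableSet_ballG R),
      ← integral_indicator (measurable_swap (measurableSet_ballG R)), Measure.volume_eq_prod,
      ← integral_prod_swap]
    rfl
  have hint : IntegrableOn (fun p => f p.swap) (Prod.swap ⁻¹' ballG R) :=
    ((hf.comp continuous_swap).continuousOn.integrableOn_compact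
      (isCompact_Icc.prod isCompact_Icc)).mono_set
      (fun p hp => (ballG_subset_Icc hR (a := p.swap) hp).symm :
        _ ⊆ Set.Icc (-R ^ 2) (R ^ 2) ×ˢ Set.Icc (-R) R)
  rw [hswap]
  refine setIntegral_le_of_slices (measurable_swap (measurableSet_ballG R)) hint (by positivity)
    (fun y hy => ⟨√√(R ^ 4 - y ^ 2), Real.sqrt_nonneg _, ?_, h y _
      (Real.sqrt_nonneg _)⟩) (fun y hy => ?_)
  · ext x
    rw [Set.mem_Ioo, ← abs_lt, Real.lt_sqrt (abs_nonneg x), sq_abs,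
      Real.lt_sqrt (sq_nonneg x), Set.mem_preimage, Set.mem_preimage, ← pow_mul]
    change x ^ 4 + y ^ 2 < R ^ 4 ↔ _
    exact lt_sub_iff_add_lt.symm
  · exact Set.eq_empty_of_forall_notMem fun x hx => hy (ballG_subset_Icc hR hx).2

theorem hasDerivAt_pdx {u : ℝ × ℝ → ℝ} (hu : ContDiff ℝ 1 u) (x y : ℝ) :
    HasDerivAt (fun t => u (t, y)) (pdx u (x, y)) x := by
  have h : Differentiable ℝ (fun t => u (t, y)) :=
    (hu.differentiable one_ne_zero).comp (by fun_prop)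
  exact (h x).hasDerivAt

theorem hasDerivAt_pdy {u : ℝ × ℝ → ℝ} (hu : ContDiff ℝ 1 u) (x y : ℝ) :
    HasDerivAt (fun t => u (x, t)) (pdy u (x, y)) y := by
  have h : Differentiable ℝ (fun t => u (x, t)) :=
    (hu.differentiable one_ne_zero).comp (by fun_prop)
  exact (h y).hasDerivAt

theorem pdx_eq_fderiv {u : ℝ × ℝ → ℝ} (hu : ContDiff ℝ 1 u) (p : ℝ × ℝ) :
    pdx u p = fderiv ℝ u p (1, 0) :=
  ((hu.differentiable one_ne_zero p).hasFDerivAt.comp_hasDerivAt p.1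
    ((hasDerivAt_id p.1).prodMk (hasDerivAt_const p.1 p.2))).deriv

theorem pdy_eq_fderiv {u : ℝ × ℝ → ℝ} (hu : ContDiff ℝ 1 u) (p : ℝ × ℝ) :
    pdy u p = fderiv ℝ u p (0, 1) :=
  ((hu.differentiable one_ne_zero p).hasFDerivAt.comp_hasDerivAt p.2
    ((hasDerivAt_const p.2 p.1).prodMk (hasDerivAt_id p.2))).deriv

theorem ContDiff.continuous_pdx {u : ℝ × ℝ → ℝ} (hu : ContDiff ℝ 1 u) :
    Continuous (pdx u) := by
  rw [funext (pdx_eq_fderiv hu)]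
  exact (hu.continuous_fderiv one_ne_zero).clm_apply continuous_const

theorem ContDiff.continuous_pdy {u : ℝ × ℝ → ℝ} (hu : ContDiff ℝ 1 u) :
    Continuous (pdy u) := by
  rw [funext (pdy_eq_fderiv hu)]
  exact (hu.continuous_fderiv one_ne_zero).clm_apply continuous_const

theorem ContDiff.pdx {u : ℝ × ℝ → ℝ} (hu : ContDiff ℝ 2 u) : ContDiff ℝ 1 (pdx u) := by
  rw [funext (pdx_eq_fderiv (hu.of_le one_le_two))]
  exact (hu.fderiv_right (m := 1) (by norm_num)).clm_apply contDiff_const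

theorem ContDiff.pdy {u : ℝ × ℝ → ℝ} (hu : ContDiff ℝ 2 u) : ContDiff ℝ 1 (pdy u) := by
  rw [funext (pdy_eq_fderiv (hu.of_le one_le_two))]
  exact (hu.fderiv_right (m := 1) (by norm_num)).clm_apply contDiff_const

theorem pdx_pdy_comm {u : ℝ × ℝ → ℝ} (hu : ContDiff ℝ 2 u) (p : ℝ × ℝ) :
    pdx (pdy u) p = pdy (pdx u) p := by
  have hu1 : ContDiff ℝ 1 u := hu.of_le one_le_two
  have hd : DifferentiableAt ℝ (fderiv ℝ u) p :=
    (hu.fderiv_right (m := 1) (by norm_num)).differentiable one_ne_zero p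
  have hcomp (v w : ℝ × ℝ) :
      fderiv ℝ (fun q => fderiv ℝ u q v) p w = fderiv ℝ (fderiv ℝ u) p w v := by
    rw [fderiv_clm_apply hd (differentiableAt_const v)]
    simp
  rw [pdx_eq_fderiv hu.pdy, pdy_eq_fderiv hu.pdx, funext (pdx_eq_fderiv hu1),
    funext (pdy_eq_fderiv hu1), hcomp, hcomp]
  exact (hu.contDiffAt.isSymmSndFDerivAt (by simp)) _ _

theorem integral_sub_integral_shift_of_pdx_eq_pdy {f g : ℝ × ℝ → ℝ} (hf : ContDiff ℝ 1 f)
    (hg : ContDiff ℝ 1 g) (hfg : ∀ p, pdx f p = pdy g p) (r y t : ℝ) :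
    ∫ x in (-r)..r, (g (x, y) - g (x, y + t))
      = ∫ s in y..(y + t), (f (-r, s) - f (r, s)) := by
  have hfd := hf.differentiable one_ne_zero
  have hgd := hg.differentiable one_ne_zero
  have hzero (p : ℝ × ℝ) : fderiv ℝ f p (1, 0) + (-fderiv ℝ g p) (0, 1) = 0 := by
    rw [neg_apply, ← pdx_eq_fderiv hf, ← pdy_eq_fderiv hg, hfg, add_neg_cancel]
  have h := integral2_divergence_prod_of_hasFDerivAt f (fun p => -g p) (fderiv ℝ f)
    (fun p => -fderiv ℝ g p) (-r) y r (y + t) hf.continuous.continuousOn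
    hg.continuous.neg.continuousOn (fun p _ => (hfd p).hasFDerivAt)
    (fun p _ => (hgd p).hasFDerivAt.neg) (by simp only [hzero]; exact integrableOn_zero)
  have hfc := hf.continuous
  have hgc := hg.continuous
  simp only [hzero, intervalIntegral.integral_neg, intervalIntegral.integral_zero] at h
  rw [intervalIntegral.integral_sub (Continuous.intervalIntegrable (by fun_prop) _ _)
      (Continuous.intervalIntegrable (by fun_prop) _ _),
    intervalIntegral.integral_sub (Continuous.intervalIntegrable (by fun_prop) _ _)
      (Continuous.intervalIntegrable (by fun_prop) _ _)]
  linarith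

theorem integral_abs_pdy_le {u : ℝ × ℝ → ℝ} (hu : ContDiff ℝ 1 u) {M : ℝ}
    (hM : ∀ p, |u p| ≤ M) (hmono : (∀ p, 0 ≤ pdy u p) ∨ ∀ p, pdy u p ≤ 0) (x c d : ℝ) :
    ∫ y in c..d, |pdy u (x, y)| ≤ 2 * M := by
  have hcont := hu.continuous_pdy
  have hftc : ∫ y in c..d, pdy u (x, y) = u (x, d) - u (x, c) :=
    intervalIntegral.integral_eq_sub_of_hasDerivAt (fun y _ => hasDerivAt_pdy hu x y)
      (Continuous.intervalIntegrable (by fun_prop) _ _)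
  have hc := abs_le.1 (hM (x, c))
  have hd := abs_le.1 (hM (x, d))
  rcases hmono with h | h
  · simp only [abs_of_nonneg (h _), hftc]
    linarith
  · simp only [abs_of_nonpos (h _), intervalIntegral.integral_neg, hftc]
    linarith

theorem setIntegral_ballG_sq_Yg_le {u : ℝ × ℝ → ℝ} (hu : ContDiff ℝ 1 u) {M : ℝ}
    (hM : ∀ p, |u p| ≤ M) (hY : ∀ p, |Yg u p| ≤ M)
    (hmono : (∀ p, 0 ≤ pdy u p) ∨ ∀ p, pdy u p ≤ 0) {R : ℝ} (hR : 0 ≤ R) :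
    ∫ p in ballG R, Yg u p ^ 2 ≤ 4 * M ^ 2 * R ^ 2 := by
  have hcont := hu.continuous_pdy
  have hYc : Continuous (Yg u) := continuous_fst.mul hcont
  have hM0 : 0 ≤ M := (abs_nonneg _).trans (hM 0)
  refine (setIntegral_ballG_le_of_vertical (K := R * M * (2 * M)) (by fun_prop) hR
    fun x hx r hr => ?_).trans (by nlinarith)
  calc ∫ y in (-r)..r, Yg u (x, y) ^ 2
      ≤ ∫ y in (-r)..r, R * M * |pdy u (x, y)| := by
        refine intervalIntegral.integral_mono_on (by linarith)
          (Continuous.intervalIntegrable (by fun_prop) _ _)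
          (Continuous.intervalIntegrable (by fun_prop) _ _) fun y _ => ?_
        calc Yg u (x, y) ^ 2 = |x| * |Yg u (x, y)| * |pdy u (x, y)| := by
              rw [← sq_abs, sq]
              nth_rw 1 [Yg]
              rw [abs_mul]
              ring
          _ ≤ R * M * |pdy u (x, y)| := by gcongr; exact hY _
    _ = R * M * ∫ y in (-r)..r, |pdy u (x, y)| := intervalIntegral.integral_const_mul _ _
    _ ≤ R * M * (2 * M) := by gcongr; exact integral_abs_pdy_le hu hM hmono x _ _

theorem setIntegral_ballG_pdx_shift_le {P : ℝ × ℝ → ℝ} (hP : ContDiff ℝ 1 P) {K : ℝ}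
    (hK : ∀ p, |P p| ≤ K) {R : ℝ} (hR : 0 ≤ R) (t : ℝ) :
    ∫ p in ballG R, pdx P (p.1, p.2 + t) ≤ 4 * K * R ^ 2 := by
  have hcont := hP.continuous_pdx
  refine (setIntegral_ballG_le_of_horizontal (K := 2 * K) (by fun_prop) hR
    fun y r hr => ?_).trans (by linarith)
  rw [intervalIntegral.integral_eq_sub_of_hasDerivAt (fun x _ => hasDerivAt_pdx hP x (y + t))
      (Continuous.intervalIntegrable (by fun_prop) _ _)]
  linarith [(abs_le.1 (hK (r, y + t))).2, (abs_le.1 (hK (-r, y + t))).1]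

theorem setIntegral_ballG_pdy_shift_le {Q : ℝ × ℝ → ℝ} (hQ : ContDiff ℝ 1 Q) {K : ℝ}
    (hK0 : 0 ≤ K) (hK : ∀ p, |Q p| ≤ |p.1| * K) {R : ℝ} (hR : 0 ≤ R) (t : ℝ) :
    ∫ p in ballG R, pdy Q (p.1, p.2 + t) ≤ 4 * K * R ^ 2 := by
  have hcont := hQ.continuous_pdy
  refine (setIntegral_ballG_le_of_vertical (K := 2 * (R * K)) (by fun_prop) hR
    fun x hx r hr => ?_).trans (by linarith)
  rw [intervalIntegral.integral_eq_sub_of_hasDerivAt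
      (fun y _ => (hasDerivAt_pdy hQ x (y + t)).comp_add_const y t)
      (Continuous.intervalIntegrable (by fun_prop) _ _)]
  have hxK : |x| * K ≤ R * K := by gcongr
  linarith [(abs_le.1 (hK (x, r + t))).2, (abs_le.1 (hK (x, -r + t))).1]

theorem deltaG_eq {u : ℝ × ℝ → ℝ} (hu : ContDiff ℝ 2 u) (p : ℝ × ℝ) :
    deltaG u p = pdx (pdx u) p + p.1 * (p.1 * pdy (pdy u) p) := by
  have h : pdy (Yg u) p = _ := ((hasDerivAt_pdy hu.pdy p.1 p.2).const_mul p.1).deriv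
  rw [← h]
  rfl

theorem pdx_add_pdy_eq_deltaG {u : ℝ × ℝ → ℝ} (hu : ContDiff ℝ 2 u) (c : ℝ) (p : ℝ × ℝ) :
    pdx (fun q => (u q - c) * pdx u q) p + pdy (fun q => (u q - c) * (q.1 * Yg u q)) p
      = Xg u p ^ 2 + Yg u p ^ 2 + (u p - c) * deltaG u p := by
  obtain ⟨x, y⟩ := p
  have hu1 : ContDiff ℝ 1 u := hu.of_le one_le_two
  have h1 : pdx (fun q => (u q - c) * pdx u q) (x, y) = _ :=
    (((hasDerivAt_pdx hu1 x y).sub_const c).mul (hasDerivAt_pdx hu.pdx x y)).deriv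
  have hY : HasDerivAt (fun t => Yg u (x, t)) (x * pdy (pdy u) (x, y)) y :=
    (hasDerivAt_pdy hu.pdy x y).const_mul x
  have h2 : pdy (fun q => (u q - c) * (q.1 * Yg u q)) (x, y) = _ :=
    (((hasDerivAt_pdy hu1 x y).sub_const c).mul (hY.const_mul x)).deriv
  rw [h1, h2, deltaG_eq hu]
  simp only [Xg, Yg]
  ring

theorem setIntegral_ballG_sq_Xg_shift_le {u : ℝ × ℝ → ℝ} (hu : ContDiff ℝ 2 u) {c M N : ℝ}
    (hM : ∀ p, |u p - c| ≤ 2 * M) (hX : ∀ p, |Xg u p| ≤ M) (hY : ∀ p, |Yg u p| ≤ M)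
    (hN : ∀ p, |deltaG u p| ≤ N) {R : ℝ} (hR : 0 ≤ R) (t : ℝ) :
    ∫ p in ballG R, Xg u (p.1, p.2 + t) ^ 2
      ≤ 16 * M ^ 2 * R ^ 2 + ∫ p in ballG R, N * |u (p.1, p.2 + t) - c| := by
  have hu1 : ContDiff ℝ 1 u := hu.of_le one_le_two
  have hM0 : 0 ≤ M := (abs_nonneg _).trans (hX 0)
  have hux := hu.pdx
  have huy := hu.pdy
  have hYC : ContDiff ℝ 1 (Yg u) := contDiff_fst.mul huy
  set P : ℝ × ℝ → ℝ := fun q => (u q - c) * pdx u q with hP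
  set Q : ℝ × ℝ → ℝ := fun q => (u q - c) * (q.1 * Yg u q) with hQ
  have hPC : ContDiff ℝ 1 P := by fun_prop
  have hQC : ContDiff ℝ 1 Q := by fun_prop
  have hPb (p : ℝ × ℝ) : |P p| ≤ 2 * M * M := by
    rw [hP, abs_mul]
    exact mul_le_mul (hM p) (hX p) (abs_nonneg _) (by positivity)
  have hQb (p : ℝ × ℝ) : |Q p| ≤ |p.1| * (2 * M * M) := by
    rw [hQ, abs_mul, abs_mul, mul_left_comm]
    gcongr
    exacts [hM p, hY p]
  have hPx := hPC.continuous_pdx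
  have hQy := hQC.continuous_pdy
  have huc := hu.continuous
  have hXc : Continuous (Xg u) := hux.continuous
  have hle (q : ℝ × ℝ) : Xg u q ^ 2 ≤ pdx P q + pdy Q q + N * |u q - c| := by
    rw [pdx_add_pdy_eq_deltaG hu c q]
    have : -((u q - c) * deltaG u q) ≤ N * |u q - c| := by
      refine (neg_le_abs _).trans ?_
      rw [abs_mul, mul_comm]
      gcongr
      exact hN q
    nlinarith [sq_nonneg (Yg u q)]
  calc ∫ p in ballG R, Xg u (p.1, p.2 + t) ^ 2
      ≤ ∫ p in ballG R, (pdx P (p.1, p.2 + t) + pdy Q (p.1, p.2 + t)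
          + N * |u (p.1, p.2 + t) - c|) :=
        setIntegral_mono (Continuous.integrableOn_ballG (by fun_prop) hR)
          (Continuous.integrableOn_ballG (by fun_prop) hR) fun p => hle _
    _ = (∫ p in ballG R, pdx P (p.1, p.2 + t)) + (∫ p in ballG R, pdy Q (p.1, p.2 + t))
          + ∫ p in ballG R, N * |u (p.1, p.2 + t) - c| := by
        rw [integral_add (Continuous.integrableOn_ballG (by fun_prop) hR)
            (Continuous.integrableOn_ballG (by fun_prop) hR),
          integral_add (Continuous.integrableOn_ballG (by fun_prop) hR)
            (Continuous.integrableOn_ballG (by fun_prop) hR)]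
    _ ≤ _ := by
        linarith [setIntegral_ballG_pdx_shift_le hPC hPb hR t,
          setIntegral_ballG_pdy_shift_le hQC (by positivity) hQb hR t]

theorem tendsto_setIntegral_ballG_shift {G : ℝ × ℝ → ℝ} (hG : Continuous G) {B : ℝ}
    (hB : ∀ p, |G p| ≤ B) (hlim : ∀ x, Tendsto (fun y => G (x, y)) atTop (nhds 0)) {R : ℝ}
    (hR : 0 ≤ R) :
    Tendsto (fun t => ∫ p in ballG R, G (p.1, p.2 + t)) atTop (nhds 0) := by
  have h := tendsto_integral_filter_of_dominated_convergence
    (μ := volume.restrict (ballG R)) (l := atTop) (F := fun (t : ℝ) p => G (p.1, p.2 + t))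
    (f := fun _ => 0) (fun _ => B)
    (Eventually.of_forall fun t => Continuous.aestronglyMeasurable (by fun_prop))
    (Eventually.of_forall fun t => Eventually.of_forall fun p => hB _)
    (Continuous.integrableOn_ballG continuous_const hR)
    (Eventually.of_forall fun p => (hlim p.1).comp (tendsto_atTop_add_const_left _ p.2 tendsto_id))
  simpa using h

/-- The density whose `y`-derivative is the `x`-derivative of `∑ i, X uᵢ * ∂_y uᵢ` along a
solution of the system. -/
noncomputable def hamiltonianDensity {m : ℕ} (Htil : (Fin m → ℝ) → ℝ) (u : Fin m → ℝ × ℝ → ℝ)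
    (p : ℝ × ℝ) : ℝ :=
  (∑ i, (1 / 2 : ℝ) * (Xg (u i) p ^ 2 - Yg (u i) p ^ 2)) + Htil (fun k => u k p)

theorem contDiff_hamiltonianDensity {m : ℕ} {Htil : (Fin m → ℝ) → ℝ} (hH : ContDiff ℝ 1 Htil)
    {u : Fin m → ℝ × ℝ → ℝ} (hu : ∀ i, ContDiff ℝ 2 (u i)) :
    ContDiff ℝ 1 (hamiltonianDensity Htil u) := by
  have hX (i : Fin m) : ContDiff ℝ 1 (Xg (u i)) := (hu i).pdx
  have hY (i : Fin m) : ContDiff ℝ 1 (Yg (u i)) := contDiff_fst.mul (hu i).pdy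
  refine ContDiff.add (ContDiff.sum fun i _ => ?_)
    (hH.comp (contDiff_pi.2 fun k => (hu k).of_le one_le_two))
  have := hX i
  have := hY i
  fun_prop

theorem pdx_eq_pdy_hamiltonianDensity {m : ℕ} {Htil : (Fin m → ℝ) → ℝ} (hH : ContDiff ℝ 1 Htil)
    {u : Fin m → ℝ × ℝ → ℝ} (hu : ∀ i, ContDiff ℝ 2 (u i))
    (hsys : ∀ i p, deltaG (u i) p = pdH Htil i (fun j => u j p)) (p : ℝ × ℝ) :
    pdx (fun q => ∑ i, Xg (u i) q * pdy (u i) q) p = pdy (hamiltonianDensity Htil u) p := by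
  obtain ⟨x, y⟩ := p
  have hu1 (i : Fin m) : ContDiff ℝ 1 (u i) := (hu i).of_le one_le_two
  have hF : pdx (fun q => ∑ i, Xg (u i) q * pdy (u i) q) (x, y) = _ :=
    (HasDerivAt.fun_sum fun i _ => (hasDerivAt_pdx (hu i).pdx x y).mul
      (hasDerivAt_pdx (hu i).pdy x y)).deriv
  have hY (i : Fin m) : HasDerivAt (fun t => Yg (u i) (x, t)) (x * pdy (pdy (u i)) (x, y)) y :=
    (hasDerivAt_pdy (hu i).pdy x y).const_mul x
  have hHd : HasDerivAt (fun t => Htil (fun k => u k (x, t)))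
      (fderiv ℝ Htil (fun k => u k (x, y)) (fun k => pdy (u k) (x, y))) y :=
    (hH.differentiable one_ne_zero _).hasFDerivAt.comp_hasDerivAt y
      (hasDerivAt_pi.2 fun k => hasDerivAt_pdy (hu1 k) x y)
  have hL : pdy (hamiltonianDensity Htil u) (x, y) = _ :=
    ((HasDerivAt.fun_sum fun i _ => ((((hasDerivAt_pdy (hu i).pdx x y).pow 2).sub
      ((hY i).pow 2)).const_mul (1 / 2 : ℝ))).add hHd).deriv
  have hchain : fderiv ℝ Htil (fun k => u k (x, y)) (fun k => pdy (u k) (x, y))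
      = ∑ i, deltaG (u i) (x, y) * pdy (u i) (x, y) := by
    rw [← ContinuousLinearMap.coe_coe, LinearMap.pi_apply_eq_sum_univ]
    refine Finset.sum_congr rfl fun i _ => ?_
    rw [hsys, smul_eq_mul, mul_comm, pdH]
    have hsingle : (Pi.single i 1 : Fin m → ℝ) = fun j => if i = j then 1 else 0 := by
      ext j
      simp [Pi.single_apply, eq_comm]
    rw [hsingle, ContinuousLinearMap.coe_coe]
  rw [hF, hL, hchain, ← Finset.sum_add_distrib]
  refine Finset.sum_congr rfl fun i _ => ?_
  rw [deltaG_eq (hu i), pdx_pdy_comm (hu i)]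
  simp only [Yg]
  push_cast
  ring

theorem setIntegral_ballG_hamiltonianDensity_sub_shift_le {m : ℕ} {Htil : (Fin m → ℝ) → ℝ}
    (hH : ContDiff ℝ 1 Htil) {u : Fin m → ℝ × ℝ → ℝ} (hu : ∀ i, ContDiff ℝ 2 (u i))
    (hsys : ∀ i p, deltaG (u i) p = pdH Htil i (fun j => u j p))
    (hmono : ∀ i, (∀ p, 0 ≤ pdy (u i) p) ∨ (∀ p, pdy (u i) p ≤ 0)) {M : ℝ} (hM0 : 0 ≤ M)
    (hM : ∀ i p, |u i p| ≤ M) (hX : ∀ i p, |Xg (u i) p| ≤ M) {R t : ℝ} (hR : 0 ≤ R)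
    (ht : 0 ≤ t) :
    ∫ p in ballG R, (hamiltonianDensity Htil u p - hamiltonianDensity Htil u (p.1, p.2 + t))
      ≤ 8 * m * M ^ 2 * R ^ 2 := by
  have hLC := contDiff_hamiltonianDensity hH hu
  have hLc := hLC.continuous
  have hFC : ContDiff ℝ 1 (fun q => ∑ i, Xg (u i) q * pdy (u i) q) :=
    ContDiff.sum fun i _ => (hu i).pdx.mul (hu i).pdy
  have hyc (i : Fin m) : Continuous (pdy (u i)) := (hu i).pdy.continuous
  have hXc (i : Fin m) : Continuous (Xg (u i)) := (hu i).pdx.continuous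
  refine (setIntegral_ballG_le_of_horizontal (K := 4 * m * M ^ 2) (by fun_prop) hR
    fun y r hr => ?_).trans (by linarith)
  rw [integral_sub_integral_shift_of_pdx_eq_pdy hFC hLC
    (pdx_eq_pdy_hamiltonianDensity hH hu hsys)]
  calc ∫ s in y..(y + t), ((∑ i, Xg (u i) (-r, s) * pdy (u i) (-r, s))
        - ∑ i, Xg (u i) (r, s) * pdy (u i) (r, s))
      ≤ ∫ s in y..(y + t), ∑ i, (M * |pdy (u i) (-r, s)| + M * |pdy (u i) (r, s)|) := by
        refine intervalIntegral.integral_mono_on (by linarith)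
          (Continuous.intervalIntegrable (by fun_prop) _ _)
          (Continuous.intervalIntegrable (by fun_prop) _ _) fun s _ => ?_
        rw [← Finset.sum_sub_distrib]
        refine Finset.sum_le_sum fun i _ => ?_
        have hb (q : ℝ × ℝ) : |Xg (u i) q * pdy (u i) q| ≤ M * |pdy (u i) q| := by
          rw [abs_mul]
          gcongr
          exact hX i q
        linarith [(abs_le.1 (hb (-r, s))).2, (abs_le.1 (hb (r, s))).1]
    _ = ∑ i, (M * (∫ s in y..(y + t), |pdy (u i) (-r, s)|)
          + M * ∫ s in y..(y + t), |pdy (u i) (r, s)|) := by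
        rw [intervalIntegral.integral_finsetSum fun i _ =>
          Continuous.intervalIntegrable (by fun_prop) _ _]
        refine Finset.sum_congr rfl fun i _ => ?_
        rw [intervalIntegral.integral_add (Continuous.intervalIntegrable (by fun_prop) _ _)
            (Continuous.intervalIntegrable (by fun_prop) _ _),
          intervalIntegral.integral_const_mul, intervalIntegral.integral_const_mul]
    _ ≤ ∑ _i : Fin m, (M * (2 * M) + M * (2 * M)) := by
        have hu1 (i : Fin m) : ContDiff ℝ 1 (u i) := (hu i).of_le one_le_two
        gcongr with i
        exacts [integral_abs_pdy_le (hu1 i) (hM i) (hmono i) _ _ _,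
          integral_abs_pdy_le (hu1 i) (hM i) (hmono i) _ _ _]
    _ = 4 * m * M ^ 2 := by
        rw [Finset.sum_const, Finset.card_univ, Fintype.card_fin, nsmul_eq_mul]
        ring

theorem normG_sq (u : ℝ × ℝ → ℝ) (p : ℝ × ℝ) : normG u p ^ 2 = Xg u p ^ 2 + Yg u p ^ 2 :=
  Real.sq_sqrt (by positivity)

theorem abs_Xg_le_normG (u : ℝ × ℝ → ℝ) (p : ℝ × ℝ) : |Xg u p| ≤ normG u p :=
  Real.abs_le_sqrt (le_add_of_nonneg_right (sq_nonneg _))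

theorem abs_Yg_le_normG (u : ℝ × ℝ → ℝ) (p : ℝ × ℝ) : |Yg u p| ≤ normG u p :=
  Real.abs_le_sqrt (le_add_of_nonneg_left (sq_nonneg _))

/-- Energy growth estimate for bounded monotone solutions of the Grushin
system converging to constants as `y → ∞`: the Grushin energy over `B_R` grows at most
like `R²`. -/
theorem stmt_11 {m : ℕ}
    (Htil : (Fin m → ℝ) → ℝ) (hHtil : ContDiff ℝ 2 Htil)
    (H : Fin m → (Fin m → ℝ) → ℝ) (hHdef : ∀ i v, H i v = pdH Htil i v)
    (u : Fin m → ℝ × ℝ → ℝ) (hu : ∀ i, ContDiff ℝ 2 (u i))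
    (hub : ∀ i, ∃ M, ∀ p, |u i p| ≤ M)
    (hsys : ∀ i p, deltaG (u i) p = H i (fun j => u j p))
    (hgradb : ∀ i, ∃ M, ∀ p, normG (u i) p ≤ M)
    (hmono : ∀ i, (∀ p, 0 ≤ pdy (u i) p) ∨ (∀ p, pdy (u i) p ≤ 0))
    (a : Fin m → ℝ)
    (hlim : ∀ i x, Filter.Tendsto (fun y => u i (x, y)) Filter.atTop (nhds (a i))) :
    ∃ C : ℝ, ∀ R > (1 : ℝ),
      (∫ p in ballG R,
        ((∑ i, (1 / 2 : ℝ) * (normG (u i) p) ^ 2) + (Htil (fun k => u k p) - Htil a)))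
        ≤ C * R ^ 2 := by
  obtain rfl : H = pdH Htil := by
    ext i v
    exact hHdef i v
  have hH1 : ContDiff ℝ 1 Htil := hHtil.of_le one_le_two
  have huc (i : Fin m) : Continuous (u i) := (hu i).continuous
  have hUc : Continuous fun p => (fun k => u k p) := continuous_pi huc
  have hXc (i : Fin m) : Continuous (Xg (u i)) := (hu i).pdx.continuous
  have hYc (i : Fin m) : Continuous (Yg (u i)) := continuous_fst.mul (hu i).pdy.continuous
  have hHc : Continuous Htil := hHtil.continuous
  obtain ⟨M, hM0, hM, hX, hY⟩ : ∃ M : ℝ, 0 ≤ M ∧ (∀ i p, |u i p| ≤ M) ∧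
      (∀ i p, |Xg (u i) p| ≤ M) ∧ ∀ i p, |Yg (u i) p| ≤ M := by
    choose M₁ hM₁ using hub
    choose M₂ hM₂ using hgradb
    have h₁ (i : Fin m) : 0 ≤ M₁ i := (abs_nonneg _).trans (hM₁ i 0)
    have h₂ (i : Fin m) : 0 ≤ M₂ i := (Real.sqrt_nonneg _).trans (hM₂ i 0)
    have hle (i : Fin m) : M₁ i + M₂ i ≤ ∑ j, (M₁ j + M₂ j) :=
      Finset.single_le_sum (fun j _ => add_nonneg (h₁ j) (h₂ j)) (Finset.mem_univ i)
    refine ⟨∑ j, (M₁ j + M₂ j), Finset.sum_nonneg fun j _ => add_nonneg (h₁ j) (h₂ j),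
      fun i p => ?_, fun i p => ?_, fun i p => ?_⟩
    · linarith [hM₁ i p, hle i, h₂ i]
    · linarith [abs_Xg_le_normG (u i) p, hM₂ i p, hle i, h₁ i]
    · linarith [abs_Yg_le_normG (u i) p, hM₂ i p, hle i, h₁ i]
  have haM (i : Fin m) : |a i| ≤ M :=
    le_of_tendsto (hlim i 0).abs (Eventually.of_forall fun y => hM i _)
  have hdiff (i : Fin m) (p : ℝ × ℝ) : |u i p - a i| ≤ 2 * M := by
    linarith [abs_sub (u i p) (a i), hM i p, haM i]
  have hmem (p : ℝ × ℝ) : (fun k => u k p) ∈ Metric.closedBall (0 : Fin m → ℝ) M := by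
    rw [mem_closedBall_zero_iff, pi_norm_le_iff_of_nonneg hM0]
    exact fun i => hM i p
  have hbdd {g : (Fin m → ℝ) → ℝ} (hg : Continuous g) : ∃ B, ∀ p, |g (fun k => u k p)| ≤ B := by
    obtain ⟨B, hB⟩ := (isCompact_closedBall (0 : Fin m → ℝ) M).exists_bound_of_continuousOn
      hg.continuousOn
    exact ⟨B, fun p => hB _ (hmem p)⟩
  have hN (i : Fin m) : ∃ N, ∀ p, |deltaG (u i) p| ≤ N := by
    simp only [hsys]
    exact hbdd ((hH1.continuous_fderiv one_ne_zero).clm_apply continuous_const)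
  choose N hN using hN
  set V : (Fin m → ℝ) → ℝ := fun v => (∑ i, (1 / 2 : ℝ) * (N i * |v i - a i|)) + (Htil v - Htil a)
    with hV
  have hVc : Continuous V := by fun_prop
  obtain ⟨B, hB⟩ := hbdd hVc
  have hVlim (x : ℝ) : Tendsto (fun y => V (fun k => u k (x, y))) atTop (nhds 0) := by
    have h := (hVc.tendsto a).comp (tendsto_pi_nhds.2 fun i => hlim i x)
    have hVa : V a = 0 := by simp [hV]
    rwa [hVa] at h
  refine ⟨8 * m * M ^ 2 + m * (4 * M ^ 2) + m * (8 * M ^ 2) + 1, fun R hR => ?_⟩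
  have hR0 : 0 ≤ R := by linarith
  obtain ⟨t, ht1, ht0⟩ := (((tendsto_setIntegral_ballG_shift (hVc.comp hUc) hB hVlim hR0).eventually
    (eventually_le_nhds zero_lt_one)).and (eventually_ge_atTop 0)).exists
  have hLc := (contDiff_hamiltonianDensity hH1 hu).continuous
  have hint {f : ℝ × ℝ → ℝ} (hf : Continuous f) : Integrable f (volume.restrict (ballG R)) :=
    hf.integrableOn_ballG hR0
  have hdens (p : ℝ × ℝ) :
      (∑ i, (1 / 2 : ℝ) * (normG (u i) p) ^ 2) + (Htil (fun k => u k p) - Htil a)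
      ≤ (hamiltonianDensity Htil u p - hamiltonianDensity Htil u (p.1, p.2 + t))
        + (∑ i, Yg (u i) p ^ 2) + (∑ i, (1 / 2 : ℝ) * Xg (u i) (p.1, p.2 + t) ^ 2)
        + (Htil (fun k => u k (p.1, p.2 + t)) - Htil a) := by
    have h₁ : ∑ i, (1 / 2 : ℝ) * (normG (u i) p) ^ 2
        = (∑ i, (1 / 2 : ℝ) * (Xg (u i) p ^ 2 - Yg (u i) p ^ 2)) + ∑ i, Yg (u i) p ^ 2 := by
      rw [← Finset.sum_add_distrib]
      refine Finset.sum_congr rfl fun i _ => ?_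
      rw [normG_sq]
      ring
    have h₂ : ∑ i, (1 / 2 : ℝ) * (Xg (u i) (p.1, p.2 + t) ^ 2 - Yg (u i) (p.1, p.2 + t) ^ 2)
        ≤ ∑ i, (1 / 2 : ℝ) * Xg (u i) (p.1, p.2 + t) ^ 2 :=
      Finset.sum_le_sum fun i _ => by nlinarith [sq_nonneg (Yg (u i) (p.1, p.2 + t))]
    rw [hamiltonianDensity, hamiltonianDensity, h₁]
    linarith
  have hshift : (∫ p in ballG R, ∑ i, (1 / 2 : ℝ) * Xg (u i) (p.1, p.2 + t) ^ 2)
      + ∫ p in ballG R, (Htil (fun k => u k (p.1, p.2 + t)) - Htil a)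
      ≤ m * (8 * M ^ 2) * R ^ 2 + ∫ p in ballG R, V (fun k => u k (p.1, p.2 + t)) := by
    simp only [hV]
    rw [integral_add (hint (by fun_prop)) (hint (by fun_prop)),
      integral_finsetSum _ fun i _ => hint (by fun_prop),
      integral_finsetSum _ fun i _ => hint (by fun_prop), ← add_assoc]
    gcongr
    calc ∑ i, ∫ p in ballG R, (1 / 2 : ℝ) * Xg (u i) (p.1, p.2 + t) ^ 2
        ≤ ∑ i, (8 * M ^ 2 * R ^ 2
          + ∫ p in ballG R, (1 / 2 : ℝ) * (N i * |u i (p.1, p.2 + t) - a i|)) := by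
          refine Finset.sum_le_sum fun i _ => ?_
          rw [integral_const_mul, integral_const_mul]
          linarith [setIntegral_ballG_sq_Xg_shift_le (hu i) (hdiff i) (hX i) (hY i) (hN i) hR0 t]
      _ = _ := by
          rw [Finset.sum_add_distrib, Finset.sum_const, Finset.card_univ, Fintype.card_fin,
            nsmul_eq_mul]
          ring
  have hYsum : ∫ p in ballG R, ∑ i, Yg (u i) p ^ 2 ≤ m * (4 * M ^ 2) * R ^ 2 := by
    rw [integral_finsetSum _ fun i _ => hint (by fun_prop)]
    calc ∑ i, ∫ p in ballG R, Yg (u i) p ^ 2 ≤ ∑ _i : Fin m, 4 * M ^ 2 * R ^ 2 :=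
          Finset.sum_le_sum fun i _ => setIntegral_ballG_sq_Yg_le ((hu i).of_le one_le_two)
            (hM i) (hY i) (hmono i) hR0
      _ = _ := by
          rw [Finset.sum_const, Finset.card_univ, Fintype.card_fin, nsmul_eq_mul]
          ring
  have hLsub := setIntegral_ballG_hamiltonianDensity_sub_shift_le hH1 hu hsys hmono hM0 hM hX hR0 ht0
  have hnc (i : Fin m) : Continuous (normG (u i)) :=
    (((hXc i).pow 2).add ((hYc i).pow 2)).sqrt
  refine (setIntegral_mono (hint (by fun_prop)) (hint (by fun_prop)) hdens).trans ?_
  rw [integral_add (hint (by fun_prop)) (hint (by fun_prop)),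
    integral_add (hint (by fun_prop)) (hint (by fun_prop)),
    integral_add (hint (by fun_prop)) (hint (by fun_prop))]
  simp only [Function.comp_apply] at ht1
  nlinarith
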